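/- arXiv:1506.03016 — 2 statements merged into one kernel-verified Lean document; each statement's English description precedes it below -/
import Mathlib

section
/- (Lemma 1.) Suppose each f_i is convex and L-smooth, n ≥ 2, and let x* be a minimizer of f. Fix x, x̃ ∈ ℝ^d and 1 ≤ b ≤ n. For each subset S ⊆ {1,…,n} with |S| = b put v_S = (1/b)·Σ_{i∈S}(∇f_i(x) − ∇f_i(x̃)) + ∇f(x̃). Then the average over all C(n,b) such subsets S of ‖v_S − ∇f(x)‖² is at most 4L·((n−b)/(b(n−1)))·( f(x) − f(x*) + f(x̃) − f(x*) ). -/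
open RealInnerProductSpace

section SVRGHelpers

variable {E : Type*} [NormedAddCommGroup E] [InnerProductSpace ℝ E] [CompleteSpace E]

theorem svrg_line_deriv {g : E → ℝ} {g' : E → E} (hg : ∀ x, HasGradientAt g (g' x) x)
    (x u : E) (t : ℝ) :
    HasDerivAt (fun s : ℝ => g (x + s • u)) (inner ℝ (g' (x + t • u)) u) t := by
  have h1 := (hg (x + t • u)).hasFDerivAt
  have h2 : HasDerivAt (fun s : ℝ => x + s • u) u t := by
    simpa using ((hasDerivAt_id t).smul_const u).const_add x
  have h3 := h1.comp_hasDerivAt t h2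
  simpa [Function.comp_def] using h3

theorem svrg_first_order {g : E → ℝ} {g' : E → E} (hg : ∀ x, HasGradientAt g (g' x) x)
    (hc : ConvexOn ℝ Set.univ g) (y z : E) :
    g y + inner ℝ (g' y) (z - y) ≤ g z := by
  have hd := svrg_line_deriv hg y (z - y) 0
  have hcv : ConvexOn ℝ Set.univ (fun s : ℝ => g (y + s • (z - y))) := by
    have := hc.comp_affineMap (AffineMap.lineMap (k := ℝ) y z)
    simpa [Function.comp_def, AffineMap.lineMap_apply, add_comm] using this
  have := hcv.le_slope_of_hasDerivAt (Set.mem_univ 0) (Set.mem_univ 1) one_pos hd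
  simp [slope_def_field] at this
  linarith

theorem svrg_descent {g : E → ℝ} {g' : E → E} (hg : ∀ x, HasGradientAt g (g' x) x)
    {L : ℝ} (hs : ∀ x y, ‖g' x - g' y‖ ≤ L * ‖x - y‖) (x u : E) :
    g (x + u) ≤ g x + inner ℝ (g' x) u + L / 2 * ‖u‖ ^ 2 := by
  have hd : ∀ t : ℝ, HasDerivAt (fun s : ℝ => g (x + s • u) - s * inner ℝ (g' x) u
      - s ^ 2 * (L / 2 * ‖u‖ ^ 2))
      (inner ℝ (g' (x + t • u)) u - inner ℝ (g' x) u - 2 * t * (L / 2 * ‖u‖ ^ 2)) t := by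
    intro t
    have h1 := svrg_line_deriv hg x u t
    have h2 := (hasDerivAt_id t).mul_const (inner ℝ (g' x) u)
    have h3 := (hasDerivAt_pow 2 t).mul_const (L / 2 * ‖u‖ ^ 2)
    refine HasDerivAt.congr_deriv ((h1.sub h2).sub h3) ?_
    norm_num
  have ha := antitoneOn_of_deriv_nonpos (convex_Icc (0 : ℝ) 1)
    (fun t _ => (hd t).continuousAt.continuousWithinAt)
    (fun t _ => (hd t).differentiableAt.differentiableWithinAt)
    (by
      intro t ht
      rw [interior_Icc] at ht
      rw [(hd t).deriv, ← inner_sub_left]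
      have h1 := real_inner_le_norm (g' (x + t • u) - g' x) u
      have h2 := hs (x + t • u) x
      rw [add_sub_cancel_left, norm_smul, Real.norm_of_nonneg ht.1.le] at h2
      have h3 := mul_le_mul_of_nonneg_right h2 (norm_nonneg u)
      nlinarith)
  have := ha (Set.left_mem_Icc.2 zero_le_one) (Set.right_mem_Icc.2 zero_le_one) zero_le_one
  simp at this
  linarith

theorem svrg_cocoercive {g : E → ℝ} {g' : E → E} (hg : ∀ x, HasGradientAt g (g' x) x)
    (hc : ConvexOn ℝ Set.univ g)
    {L : ℝ} (hL : 0 < L) (hs : ∀ x y, ‖g' x - g' y‖ ≤ L * ‖x - y‖) (x y : E) :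
    ‖g' x - g' y‖ ^ 2 ≤ 2 * L * (g x - g y - inner ℝ (g' y) (x - y)) := by
  set w := g' x - g' y with hw
  have h1 := svrg_descent hg hs x (-(L⁻¹ • w))
  have h2 := svrg_first_order hg hc y (x + -(L⁻¹ • w))
  have h3 : inner ℝ (g' x) w = inner ℝ (g' y) w + ‖w‖ ^ 2 := by
    rw [← real_inner_self_eq_norm_sq, ← inner_add_left, hw]; simp
  rw [show x + -(L⁻¹ • w) - y = (x - y) + -(L⁻¹ • w) by abel, inner_add_right] at h2
  simp only [inner_neg_right, inner_smul_right, norm_neg, norm_smul, norm_inv, Real.norm_eq_abs,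
    abs_of_pos hL] at h1 h2
  rw [h3] at h1
  have h4 : L / 2 * (L⁻¹ * ‖w‖) ^ 2 = L⁻¹ * ‖w‖ ^ 2 / 2 := by field_simp
  have h5 : L⁻¹ * ‖w‖ ^ 2 / 2 ≤ g x - g y - inner ℝ (g' y) (x - y) := by
    rw [h4] at h1; linarith
  calc ‖w‖ ^ 2 = 2 * L * (L⁻¹ * ‖w‖ ^ 2 / 2) := by field_simp
    _ ≤ _ := by gcongr

theorem svrg_sum_subsets {m c : ℕ} (w : Fin (m + 2) → E) (hw : ∑ i, w i = 0) :
    ∑ S ∈ Finset.powersetCard (c + 1) (Finset.univ : Finset (Fin (m + 2))), ‖∑ i ∈ S, w i‖ ^ 2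
      = (m.choose c : ℝ) * ∑ i, ‖w i‖ ^ 2 := by
  classical
  have key : ∀ S : Finset (Fin (m + 2)), ‖∑ i ∈ S, w i‖ ^ 2
      = ∑ i, ∑ j, if i ∉ S ∧ j ∉ S then inner ℝ (w i) (w j) else 0 := by
    intro S
    have h1 : ∑ i ∈ S, w i = - ∑ i ∈ Sᶜ, w i := by
      rw [eq_neg_iff_add_eq_zero, Finset.sum_add_sum_compl, hw]
    have h2 : ∑ i ∈ Sᶜ, w i = ∑ i, if i ∉ S then w i else 0 := by
      rw [← Finset.sum_filter]; congr 1; ext; simp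
    rw [h1, norm_neg, h2, ← real_inner_self_eq_norm_sq, sum_inner]
    refine Finset.sum_congr rfl fun i _ => ?_
    rw [inner_sum]
    refine Finset.sum_congr rfl fun j _ => ?_
    by_cases hi : i ∈ S <;> by_cases hj : j ∈ S <;> simp [hi, hj]
  have cnt : ∀ i j : Fin (m + 2),
      ∑ S ∈ Finset.powersetCard (c + 1) (Finset.univ : Finset (Fin (m + 2))),
        (if i ∉ S ∧ j ∉ S then inner ℝ (w i) (w j) else 0)
      = (m.choose (c + 1) : ℝ) * inner ℝ (w i) (w j)
        + if i = j then (m.choose c : ℝ) * ‖w i‖ ^ 2 else 0 := by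
    intro i j
    rw [← Finset.sum_filter, Finset.sum_const, nsmul_eq_mul]
    have hf : (Finset.powersetCard (c + 1) (Finset.univ : Finset (Fin (m + 2)))).filter
        (fun S => i ∉ S ∧ j ∉ S) = Finset.powersetCard (c + 1) ({i, j}ᶜ) := by
      ext S
      simp only [Finset.mem_filter, Finset.mem_powersetCard, Finset.subset_univ, true_and,
        Finset.subset_compl_comm (s := S), Finset.insert_subset_iff, Finset.singleton_subset_iff,
        Finset.mem_compl]
      tauto
    rw [hf, Finset.card_powersetCard, Finset.card_compl, Fintype.card_fin]
    by_cases hij : i = j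
    · subst hij
      simp [Nat.choose_succ_succ]
      ring
    · simp [Finset.card_pair hij, hij]
  simp_rw [key]
  rw [Finset.sum_comm]
  simp_rw [Finset.sum_comm (s := Finset.powersetCard _ _), cnt, Finset.sum_add_distrib,
    ← Finset.mul_sum, ← inner_sum, hw]
  simp [Finset.mul_sum]

end SVRGHelpers

/-- **Lemma 1 (variance bound for the mini-batch SVRG direction).**
If each `f i : ℝ^d → ℝ` is convex and `L`-smooth, `n ≥ 2`, `f = (1/n) Σ f i`, `x*` minimizes
`f`, and for every size-`b` subset `S ⊆ {1,…,n}` we set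
`v_S = (1/b) Σ_{i∈S} (∇f_i(x) − ∇f_i(x̃)) + ∇f(x̃)`, then the average over all `C(n,b)` such
subsets of `‖v_S − ∇f(x)‖²` is at most
`4L ((n−b)/(b(n−1))) (f(x) − f(x*) + f(x̃) − f(x*))`. -/
theorem svrg_minibatch_variance_bound {dd : ℕ} (n : ℕ) (hn : 2 ≤ n) (L : ℝ) (hL : 0 < L)
    (f : Fin n → EuclideanSpace ℝ (Fin dd) → ℝ)
    (f' : Fin n → EuclideanSpace ℝ (Fin dd) → EuclideanSpace ℝ (Fin dd))
    (hgrad : ∀ i x, HasGradientAt (f i) (f' i x) x)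
    (hconv : ∀ i, ConvexOn ℝ Set.univ (f i))
    (hsmooth : ∀ i x y, ‖f' i x - f' i y‖ ≤ L * ‖x - y‖)
    (F : EuclideanSpace ℝ (Fin dd) → ℝ)
    (hF : F = fun x => (n : ℝ)⁻¹ * ∑ i, f i x)
    (Fg : EuclideanSpace ℝ (Fin dd) → EuclideanSpace ℝ (Fin dd))
    (hFg : Fg = fun x => (n : ℝ)⁻¹ • ∑ i, f' i x)
    (xstar : EuclideanSpace ℝ (Fin dd)) (hmin : ∀ y, F xstar ≤ F y)
    (x xt : EuclideanSpace ℝ (Fin dd)) (b : ℕ) (hb1 : 1 ≤ b) (hbn : b ≤ n)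
    (v : Finset (Fin n) → EuclideanSpace ℝ (Fin dd))
    (hv : ∀ S, v S = (b : ℝ)⁻¹ • (∑ i ∈ S, (f' i x - f' i xt)) + Fg xt) :
    ((n.choose b : ℝ))⁻¹ *
        ∑ S ∈ Finset.powersetCard b (Finset.univ : Finset (Fin n)), ‖v S - Fg x‖ ^ 2 ≤
      4 * L * (((n : ℝ) - b) / (b * ((n : ℝ) - 1))) *
        (F x - F xstar + (F xt - F xstar)) := by
  classical
  obtain ⟨m, rfl⟩ : ∃ m, n = m + 2 := ⟨n - 2, by omega⟩
  obtain ⟨c, rfl⟩ : ∃ c, b = c + 1 := ⟨b - 1, by omega⟩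
  have hn0 : (0 : ℝ) < ((m + 2 : ℕ) : ℝ) := by positivity
  -- per-point bound
  have hcrit : ∀ u, ∑ i, inner ℝ (f' i xstar) u = 0 := by
    intro u
    have hd : HasDerivAt (fun s : ℝ => ∑ i, f i (xstar + s • u))
        (∑ i, inner ℝ (f' i (xstar + (0 : ℝ) • u)) u) 0 :=
      HasDerivAt.fun_sum fun i _ => svrg_line_deriv (hgrad i) xstar u 0
    have hm : IsLocalMin (fun s : ℝ => ∑ i, f i (xstar + s • u)) 0 := by
      refine Filter.Eventually.of_forall fun s => ?_
      have := hmin (xstar + s • u)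
      simp only [hF] at this
      simpa using le_of_mul_le_mul_left this (inv_pos.2 hn0)
    simpa using hm.hasDerivAt_eq_zero hd
  have hpt : ∀ y, ∑ i, ‖f' i y - f' i xstar‖ ^ 2 ≤
      2 * L * (((m + 2 : ℕ) : ℝ) * (F y - F xstar)) := by
    intro y
    have h1 := Finset.sum_le_sum fun i (_ : i ∈ Finset.univ) =>
      svrg_cocoercive (hgrad i) (hconv i) hL (hsmooth i) y xstar
    rw [← Finset.mul_sum, Finset.sum_sub_distrib, Finset.sum_sub_distrib, hcrit] at h1
    refine h1.trans (le_of_eq ?_)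
    rw [hF]
    field_simp
    ring
  set z : Fin (m + 2) → EuclideanSpace ℝ (Fin dd) := fun i => f' i x - f' i xt with hz
  set Z := Fg x - Fg xt with hZ
  have hsumz : ∑ i, z i = ((m + 2 : ℕ) : ℝ) • Z := by
    rw [hZ, hFg]
    simp only [hz]
    rw [Finset.sum_sub_distrib, ← smul_sub, smul_smul, mul_inv_cancel₀ hn0.ne', one_smul]
  have hw0 : ∑ i, (z i - Z) = 0 := by
    rw [Finset.sum_sub_distrib, hsumz]
    simp [← Nat.cast_smul_eq_nsmul ℝ]
  have hwz : ∑ i, ‖z i - Z‖ ^ 2 ≤ ∑ i, ‖z i‖ ^ 2 := by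
    have : ∑ i, ‖z i‖ ^ 2 = ∑ i, ‖z i - Z‖ ^ 2 + 2 * inner ℝ (∑ i, (z i - Z)) Z
        + ∑ i : Fin (m + 2), ‖Z‖ ^ 2 := by
      rw [sum_inner, Finset.mul_sum, ← Finset.sum_add_distrib, ← Finset.sum_add_distrib]
      refine Finset.sum_congr rfl fun i _ => ?_
      rw [← norm_add_sq_real, sub_add_cancel]
    rw [this, hw0, inner_zero_left]
    have : 0 ≤ ∑ i : Fin (m + 2), ‖Z‖ ^ 2 := by positivity
    linarith
  have hzb : ∑ i, ‖z i‖ ^ 2 ≤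
      4 * L * (((m + 2 : ℕ) : ℝ) * (F x - F xstar + (F xt - F xstar))) := by
    have : ∑ i, ‖z i‖ ^ 2 ≤
        ∑ i, (2 * ‖f' i x - f' i xstar‖ ^ 2 + 2 * ‖f' i xt - f' i xstar‖ ^ 2) := by
      refine Finset.sum_le_sum fun i _ => ?_
      have h1 := parallelogram_law_with_norm ℝ (f' i x - f' i xstar) (f' i xt - f' i xstar)
      rw [sub_sub_sub_cancel_right] at h1
      have h2 := mul_self_nonneg ‖f' i x - f' i xstar + (f' i xt - f' i xstar)‖
      simp only [hz]
      nlinarith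
    rw [Finset.sum_add_distrib, ← Finset.mul_sum, ← Finset.mul_sum] at this
    have h1 := hpt x
    have h2 := hpt xt
    linarith
  have hvS : ∀ S ∈ Finset.powersetCard (c + 1) (Finset.univ : Finset (Fin (m + 2))),
      ‖v S - Fg x‖ ^ 2 = (((c + 1 : ℕ) : ℝ)⁻¹) ^ 2 * ‖∑ i ∈ S, (z i - Z)‖ ^ 2 := by
    intro S hS
    have hcard := (Finset.mem_powersetCard.1 hS).2
    have hc0 : ((c + 1 : ℕ) : ℝ) ≠ 0 := by positivity
    have : v S - Fg x = ((c + 1 : ℕ) : ℝ)⁻¹ • ∑ i ∈ S, (z i - Z) := by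
      have hs : ∑ i ∈ S, (z i - Z) = S.sum z - ((c + 1 : ℕ) : ℝ) • Z := by
        rw [Finset.sum_sub_distrib, Finset.sum_const, hcard, ← Nat.cast_smul_eq_nsmul ℝ]
      rw [hs, hv, smul_sub, smul_smul, inv_mul_cancel₀ hc0, one_smul, hZ]
      abel
    rw [this, norm_smul, mul_pow, Real.norm_of_nonneg (by positivity)]
  rw [Finset.sum_congr rfl hvS, ← Finset.mul_sum, svrg_sum_subsets _ hw0]
  have hcm : c ≤ m + 1 := by omega
  have e1 : ((m : ℝ) + 2) * ((m + 1).choose c : ℝ) = ((m + 2).choose (c + 1) : ℝ) * (c + 1) := by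
    have := Nat.add_one_mul_choose_eq (m + 1) c
    exact_mod_cast this
  have e2 : (m.choose c : ℝ) * (m + 1) = ((m + 1).choose c : ℝ) * (m + 1 - c) := by
    have := congrArg (Nat.cast : ℕ → ℝ) (Nat.choose_mul_succ_eq m c)
    push_cast [Nat.cast_sub hcm] at this
    exact this
  have hC : (0 : ℝ) < ((m + 2).choose (c + 1) : ℝ) := by
    exact_mod_cast Nat.choose_pos hbn
  have hcm' : (c : ℝ) ≤ m + 1 := by exact_mod_cast hcm
  have hK : ((m + 2).choose (c + 1) : ℝ)⁻¹ * ((((c + 1 : ℕ) : ℝ)⁻¹) ^ 2 * (m.choose c : ℝ))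
      = (((m + 2 : ℕ) : ℝ) - (c + 1 : ℕ)) / ((c + 1 : ℕ) * (((m + 2 : ℕ) : ℝ) - 1))
        * ((m + 2 : ℕ) : ℝ)⁻¹ := by
    push_cast
    rw [show (m : ℝ) + 2 - 1 = m + 1 by ring, show (m : ℝ) + 2 - (c + 1) = m + 1 - c by ring]
    have a1 : (m : ℝ) + 1 ≠ 0 := by positivity
    have a2 : (m : ℝ) + 2 ≠ 0 := by positivity
    have a3 : (c : ℝ) + 1 ≠ 0 := by positivity
    have a4 := hC.ne'
    field_simp
    linear_combination ((m : ℝ) + 2) * e2 + ((m : ℝ) + 1 - c) * e1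
  have hR : 0 ≤ (((m + 2 : ℕ) : ℝ) - (c + 1 : ℕ)) / ((c + 1 : ℕ) * (((m + 2 : ℕ) : ℝ) - 1)) := by
    push_cast
    apply div_nonneg
    · linarith
    · exact mul_nonneg (by positivity) (by linarith [(Nat.cast_nonneg m : (0 : ℝ) ≤ m)])
  calc _ = (((m + 2).choose (c + 1) : ℝ)⁻¹ * ((((c + 1 : ℕ) : ℝ)⁻¹) ^ 2 * (m.choose c : ℝ)))
        * ∑ i, ‖z i - Z‖ ^ 2 := by ring
    _ ≤ _ := by
      rw [hK]
      refine (mul_le_mul_of_nonneg_left (hwz.trans hzb)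
        (mul_nonneg hR (inv_nonneg.2 hn0.le))).trans (le_of_eq ?_)
      generalize (((m + 2 : ℕ) : ℝ) - (c + 1 : ℕ)) / ((c + 1 : ℕ) * (((m + 2 : ℕ) : ℝ) - 1)) = R
      field_simp
end

section
/- (Theorem 1, first bound.) In the setting of Algorithm 1 above, set η = 1/L, α_{k+1} = (k+2)/(4L), and 1/τ_k = L·α_{k+1} + 1/2 for k = 0,1,…,m. Let p ∈ (0, 1/2] and suppose the batch sizes b_{k+1} ∈ {1,…,n} are chosen so that 4L·δ_{k+1}·α_{k+1} ≤ p for all k = 0,…,m, where δ_k = (n−b_k)/(b_k(n−1)). Then E[ f(y_{m+1}) − f(x*) ] ≤ 16L·V_{z_0}(x*)/(m+2)² + (5/2)·p·( f(y_0) − f(x*) ), where E denotes expectation over the uniform product measure on batch choices. -/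
open RealInnerProductSpace

section helpers

set_option linter.unusedSectionVars false

variable {H : Type*} [NormedAddCommGroup H] [InnerProductSpace ℝ H] [CompleteSpace H]

lemma aux_line_deriv (f : H → ℝ) (f' : H → H) (hg : ∀ x, HasGradientAt f (f' x) x) (x u : H) (t : ℝ) :
    HasDerivAt (fun t : ℝ => f (x + t • u)) ⟪f' (x + t • u), u⟫ t := by
  have h1 := (hasGradientAt_iff_hasFDerivAt.1 (hg (x + t • u)))
  have h2 : HasDerivAt (fun t : ℝ => x + t • u) u t := by
    simpa using ((hasDerivAt_id t).smul_const u).const_add x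
  have := h1.comp_hasDerivAt t h2
  simpa [Function.comp_def] using this

lemma aux_descent (f : H → ℝ) (f' : H → H) (hg : ∀ x, HasGradientAt f (f' x) x) (L : ℝ)
    (hs : ∀ x y, ‖f' x - f' y‖ ≤ L * ‖x - y‖) (x y : H) :
    f y ≤ f x + ⟪f' x, y - x⟫ + L / 2 * ‖y - x‖ ^ 2 := by
  set u := y - x with hu
  let h : ℝ → ℝ := fun t => f (x + t • u) - t * ⟪f' x, u⟫ - t ^ 2 * (L / 2 * ‖u‖ ^ 2)
  have hd : ∀ t, HasDerivAt h (⟪f' (x + t • u), u⟫ - ⟪f' x, u⟫ - 2 * t * (L / 2 * ‖u‖ ^ 2)) t := by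
    intro t
    have h1 := ((hasDerivAt_id t).mul_const ⟪f' x, u⟫)
    have h2 := ((hasDerivAt_pow 2 t).mul_const (L / 2 * ‖u‖ ^ 2))
    have := ((aux_line_deriv f f' hg x u t).sub h1).sub h2
    refine HasDerivAt.congr_deriv (f' := _) this ?_
    simp
  have anti : AntitoneOn h (Set.Ici 0) := by
    apply antitoneOn_of_deriv_nonpos (convex_Ici 0)
    · exact fun t _ => (hd t).continuousAt.continuousWithinAt
    · exact fun t _ => (hd t).differentiableAt.differentiableWithinAt
    · intro t ht
      rw [(hd t).deriv]
      simp only [interior_Ici, Set.mem_Ioi] at ht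
      rw [← inner_sub_left]
      have h1 := real_inner_le_norm (f' (x + t • u) - f' x) u
      have h2 := hs (x + t • u) x
      have h3 : ‖x + t • u - x‖ = t * ‖u‖ := by
        rw [add_sub_cancel_left, norm_smul, Real.norm_of_nonneg ht.le]
      rw [h3] at h2
      have := mul_le_mul_of_nonneg_right h2 (norm_nonneg u)
      nlinarith
  have := anti (Set.mem_Ici.2 le_rfl) (Set.mem_Ici.2 zero_le_one) zero_le_one
  simp only [h, hu] at this
  simp at this
  linarith

lemma aux_first_order (f : H → ℝ) (f' : H → H) (hg : ∀ x, HasGradientAt f (f' x) x)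
    (hc : ConvexOn ℝ Set.univ f) (x y : H) :
    f x + ⟪f' x, y - x⟫ ≤ f y := by
  have hc1 : ConvexOn ℝ Set.univ (fun t : ℝ => f (x + t • (y - x))) := by
    have := hc.comp_affineMap (AffineMap.lineMap x y)
    simpa [Function.comp_def, AffineMap.lineMap_apply, add_comm] using this
  have hd := aux_line_deriv f f' hg x (y - x) 0
  have := hc1.le_slope_of_hasDerivAt (Set.mem_univ _) (Set.mem_univ _) zero_lt_one hd
  simp [slope_def_field] at this
  linarith

lemma aux_coercive (f : H → ℝ) (f' : H → H) (L : ℝ) (hL : 0 < L)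
    (hd : ∀ x y, f y ≤ f x + ⟪f' x, y - x⟫ + L / 2 * ‖y - x‖ ^ 2)
    (hc : ∀ x y, f x + ⟪f' x, y - x⟫ ≤ f y) (x s : H) :
    ‖f' x - f' s‖ ^ 2 ≤ 2 * L * (f x - f s - ⟪f' s, x - s⟫) := by
  set e := f' x - f' s with he
  have h1 := hd x (x - L⁻¹ • e)
  have h2 := hc s (x - L⁻¹ • e)
  have e1 : x - L⁻¹ • e - x = - (L⁻¹ • e) := by abel
  have e2 : x - L⁻¹ • e - s = (x - s) - L⁻¹ • e := by abel
  rw [e1, norm_neg, norm_smul, inner_neg_right, inner_smul_right] at h1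
  rw [e2, inner_sub_right, inner_smul_right] at h2
  have h3 : ⟪f' x, e⟫ - ⟪f' s, e⟫ = ‖e‖ ^ 2 := by
    rw [← inner_sub_left, ← he, real_inner_self_eq_norm_sq]
  rw [Real.norm_of_nonneg (inv_nonneg.2 hL.le)] at h1
  have h4 : L / 2 * (L⁻¹ * ‖e‖) ^ 2 = L⁻¹ / 2 * ‖e‖ ^ 2 := by field_simp
  rw [h4] at h1
  have h5 : L⁻¹ / 2 * ‖e‖ ^ 2 ≤ f x - f s - ⟪f' s, x - s⟫ := by
    have : L⁻¹ * ⟪f' x, e⟫ - L⁻¹ * ⟪f' s, e⟫ = L⁻¹ * ‖e‖ ^ 2 := by rw [← h3]; ring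
    linarith
  calc ‖e‖ ^ 2 = 2 * L * (L⁻¹ / 2 * ‖e‖ ^ 2) := by field_simp
    _ ≤ _ := by gcongr

/-- mirror descent step -/
lemma aux_mirror (d : H → ℝ) (dg : H → H)
    (hdsc : ∀ x y, d y ≥ d x + ⟪dg x, y - x⟫ + (1 / 2) * ‖y - x‖ ^ 2)
    (V : H → H → ℝ) (hV : ∀ x y, V x y = d y - d x - ⟪dg x, y - x⟫)
    (z z' v u : H) (a : ℝ) (hz : dg z' = dg z - a • v) :
    V z' u ≤ V z u + a ^ 2 / 2 * ‖v‖ ^ 2 - a * ⟪v, z - u⟫ := by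
  have h1 := hdsc z z'
  have h2 : 0 ≤ ‖(z' - z) + a • v‖ ^ 2 := sq_nonneg _
  rw [norm_add_sq_real, norm_smul, mul_pow, Real.norm_eq_abs, sq_abs, inner_smul_right,
    real_inner_comm] at h2
  rw [hV, hV, hz, inner_sub_left, inner_smul_left]
  simp only [inner_sub_right, conj_trivial] at *
  linarith

lemma aux_dg_inj (d : H → ℝ) (dg : H → H)
    (hdsc : ∀ x y, d y ≥ d x + ⟪dg x, y - x⟫ + (1 / 2) * ‖y - x‖ ^ 2) (z w : H)
    (h : dg z = dg w) : z = w := by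
  have h1 := hdsc z w
  have h2 := hdsc w z
  rw [h] at h1
  rw [norm_sub_rev] at h1
  have : ‖z - w‖ ^ 2 ≤ 0 := by
    simp only [inner_sub_right] at *
    linarith
  have : ‖z - w‖ = 0 := by nlinarith [norm_nonneg (z - w)]
  exact sub_eq_zero.1 (norm_eq_zero.1 this)

/-- symmetry: number of `b`-subsets containing `i`, and containing `i` and `j`. -/
lemma aux_count (n b : ℕ) (hn : 2 ≤ n) (hb1 : 1 ≤ b) :
    ∃ c1 c2 : ℝ, (∀ i : Fin n, ∑ S ∈ Finset.powersetCard b (Finset.univ : Finset (Fin n)),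
        (if i ∈ S then (1 : ℝ) else 0) = c1) ∧
      (∀ i j : Fin n, i ≠ j → ∑ S ∈ Finset.powersetCard b (Finset.univ : Finset (Fin n)),
        (if i ∈ S then (1 : ℝ) else 0) * (if j ∈ S then (1 : ℝ) else 0) = c2) ∧
      n * c1 = n.choose b * b ∧ (n - 1) * c2 = (b - 1) * c1 := by
  classical
  have inv : ∀ (π : Equiv.Perm (Fin n)) (g : Finset (Fin n) → ℝ),
      ∑ S ∈ Finset.powersetCard b (Finset.univ : Finset (Fin n)), g (S.map π.toEmbedding)
        = ∑ S ∈ Finset.powersetCard b (Finset.univ : Finset (Fin n)), g S := by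
    intro π g
    have := Finset.powersetCard_map π.toEmbedding b (Finset.univ : Finset (Fin n))
    rw [Finset.map_univ_equiv] at this
    conv_rhs => rw [this, Finset.sum_map]
    rfl
  have mem : ∀ (π : Equiv.Perm (Fin n)) (i : Fin n) (S : Finset (Fin n)),
      π i ∈ S.map π.toEmbedding ↔ i ∈ S := by
    intro π i S; simp
  let i0 : Fin n := ⟨0, by omega⟩
  let i1 : Fin n := ⟨1, by omega⟩
  have h01 : i0 ≠ i1 := by simp [i0, i1]
  set c1 := ∑ S ∈ Finset.powersetCard b (Finset.univ : Finset (Fin n)),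
        (if i0 ∈ S then (1 : ℝ) else 0) with hc1
  set c2 := ∑ S ∈ Finset.powersetCard b (Finset.univ : Finset (Fin n)),
        (if i0 ∈ S then (1 : ℝ) else 0) * (if i1 ∈ S then (1 : ℝ) else 0) with hc2
  have H1 : ∀ i : Fin n, ∑ S ∈ Finset.powersetCard b (Finset.univ : Finset (Fin n)),
        (if i ∈ S then (1 : ℝ) else 0) = c1 := by
    intro i
    rw [← inv (Equiv.swap i0 i), hc1]
    refine Finset.sum_congr rfl fun S _ => ?_
    have := mem (Equiv.swap i0 i) i0 S
    rw [Equiv.swap_apply_left] at this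
    simp only [this]
  have H2 : ∀ i j : Fin n, i ≠ j → ∑ S ∈ Finset.powersetCard b (Finset.univ : Finset (Fin n)),
        (if i ∈ S then (1 : ℝ) else 0) * (if j ∈ S then (1 : ℝ) else 0) = c2 := by
    intro i j hij
    obtain ⟨π, hπ0, hπ1⟩ : ∃ π : Equiv.Perm (Fin n), π i0 = i ∧ π i1 = j := by
      refine ⟨(Equiv.swap i0 i).trans (Equiv.swap ((Equiv.swap i0 i) i1) j), ?_, ?_⟩
      · simp only [Equiv.trans_apply, Equiv.swap_apply_left]
        apply Equiv.swap_apply_of_ne_of_ne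
        · intro h
          apply h01
          apply (Equiv.swap i0 i).injective
          rw [Equiv.swap_apply_left]; exact h
        · exact hij
      · simp
    rw [← inv π, hc2]
    refine Finset.sum_congr rfl fun S _ => ?_
    have h0 := mem π i0 S
    have h1 := mem π i1 S
    rw [hπ0] at h0
    rw [hπ1] at h1
    simp only [h0, h1]
  refine ⟨c1, c2, H1, H2, ?_, ?_⟩
  · have : ∑ i : Fin n, ∑ S ∈ Finset.powersetCard b (Finset.univ : Finset (Fin n)),
        (if i ∈ S then (1 : ℝ) else 0) = n * c1 := by
      simp [H1]
    rw [← this, Finset.sum_comm]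
    rw [Finset.sum_congr rfl (g := fun _ => (b : ℝ))]
    · simp
    · intro S hS
      simp [(Finset.mem_powersetCard.1 hS).2]
  · have : ∑ j : Fin n, ∑ S ∈ Finset.powersetCard b (Finset.univ : Finset (Fin n)),
        (if i0 ∈ S then (1 : ℝ) else 0) * (if j ∈ S then (1 : ℝ) else 0) = c1 + (n - 1) * c2 := by
      rw [← Finset.add_sum_erase _ _ (Finset.mem_univ i0)]
      congr 1
      · rw [hc1]
        refine Finset.sum_congr rfl fun S _ => ?_
        split_ifs <;> simp
      · rw [Finset.sum_congr rfl (g := fun _ => c2)]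
        · simp [Finset.card_erase_of_mem, Nat.cast_sub (show 1 ≤ n by omega)]
        · intro j hj
          exact H2 i0 j (Finset.ne_of_mem_erase hj).symm
    rw [Finset.sum_comm] at this
    rw [Finset.sum_congr rfl (g := fun S => (if i0 ∈ S then (1 : ℝ) else 0) * b),
      ← Finset.sum_mul] at this
    · linarith
    · intro S hS
      rw [← Finset.mul_sum]
      simp [(Finset.mem_powersetCard.1 hS).2]

lemma aux_var (n b : ℕ) (hn : 2 ≤ n) (hb1 : 1 ≤ b) (hbn : b ≤ n) (w : Fin n → H) :
    (∑ S ∈ Finset.powersetCard b (Finset.univ : Finset (Fin n)),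
      ((b : ℝ)⁻¹ • ∑ i ∈ S, w i - (n : ℝ)⁻¹ • ∑ i, w i) = 0) ∧
    (∑ S ∈ Finset.powersetCard b (Finset.univ : Finset (Fin n)),
      ‖(b : ℝ)⁻¹ • ∑ i ∈ S, w i - (n : ℝ)⁻¹ • ∑ i, w i‖ ^ 2 ≤
      n.choose b * (((n : ℝ) - b) / (b * ((n : ℝ) - 1)) * ((n : ℝ)⁻¹ * ∑ i, ‖w i‖ ^ 2))) := by
  classical
  obtain ⟨c1, c2, H1, H2, h1, h2⟩ := aux_count n b hn hb1
  have hn0 : (n : ℝ) ≠ 0 := by positivity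
  have hb0 : (b : ℝ) ≠ 0 := by positivity
  have hn2 : (2 : ℝ) ≤ n := by exact_mod_cast hn
  have hn1 : (n : ℝ) - 1 ≠ 0 := by linarith
  have hbn' : (b : ℝ) ≤ n := by exact_mod_cast hbn
  set μ := (n : ℝ)⁻¹ • ∑ i, w i with hμ
  set u : Fin n → H := fun i => w i - μ with hu
  have hu0 : ∑ i, u i = 0 := by
    simp only [hu, Finset.sum_sub_distrib, Finset.sum_const, Finset.card_univ, Fintype.card_fin]
    rw [hμ, ← Nat.cast_smul_eq_nsmul ℝ, smul_smul, mul_inv_cancel₀ hn0, one_smul, sub_self]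
  have hS : ∀ S ∈ Finset.powersetCard b (Finset.univ : Finset (Fin n)),
      (b : ℝ)⁻¹ • ∑ i ∈ S, w i - μ = (b : ℝ)⁻¹ • ∑ i, (if i ∈ S then (1 : ℝ) else 0) • u i := by
    intro S hS
    have hc := (Finset.mem_powersetCard.1 hS).2
    simp only [ite_smul, one_smul, zero_smul, Finset.sum_ite_mem, Finset.univ_inter, hu,
      Finset.sum_sub_distrib, Finset.sum_const, hc]
    rw [← Nat.cast_smul_eq_nsmul ℝ, smul_sub, smul_smul, inv_mul_cancel₀ hb0, one_smul]
  constructor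
  · rw [Finset.sum_congr rfl hS, ← Finset.smul_sum, Finset.sum_comm]
    simp_rw [← Finset.sum_smul, H1, ← Finset.smul_sum, hu0, smul_zero]
  · have key : ∑ S ∈ Finset.powersetCard b (Finset.univ : Finset (Fin n)),
        ‖∑ i, (if i ∈ S then (1 : ℝ) else 0) • u i‖ ^ 2 = (c1 - c2) * ∑ i, ‖u i‖ ^ 2 := by
      have e1 : ∀ S : Finset (Fin n), ‖∑ i, (if i ∈ S then (1 : ℝ) else 0) • u i‖ ^ 2
          = ∑ i, ∑ j, ((if i ∈ S then (1 : ℝ) else 0) * (if j ∈ S then (1 : ℝ) else 0)) * ⟪u i, u j⟫ := by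
        intro S
        rw [← real_inner_self_eq_norm_sq, sum_inner]
        refine Finset.sum_congr rfl fun i _ => ?_
        rw [inner_sum]
        refine Finset.sum_congr rfl fun j _ => ?_
        rw [real_inner_smul_left, real_inner_smul_right]; ring
      simp_rw [e1]
      rw [Finset.sum_comm]
      have e2 : ∀ i, ∑ S ∈ Finset.powersetCard b (Finset.univ : Finset (Fin n)),
          ∑ j, ((if i ∈ S then (1 : ℝ) else 0) * (if j ∈ S then (1 : ℝ) else 0)) * ⟪u i, u j⟫
          = (c1 - c2) * ‖u i‖ ^ 2 := by
        intro i
        rw [Finset.sum_comm]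
        simp_rw [← Finset.sum_mul]
        have e3 : ∀ j, (∑ S ∈ Finset.powersetCard b (Finset.univ : Finset (Fin n)),
            ((if i ∈ S then (1 : ℝ) else 0) * (if j ∈ S then (1 : ℝ) else 0))) * ⟪u i, u j⟫
            = c2 * ⟪u i, u j⟫ + (if j = i then (c1 - c2) * ‖u i‖ ^ 2 else 0) := by
          intro j
          by_cases hij : j = i
          · subst hij
            have : ∑ S ∈ Finset.powersetCard b (Finset.univ : Finset (Fin n)),
              ((if j ∈ S then (1 : ℝ) else 0) * (if j ∈ S then (1 : ℝ) else 0)) = c1 := by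
              rw [← H1 j]
              refine Finset.sum_congr rfl fun S _ => ?_
              split_ifs <;> simp
            rw [this, real_inner_self_eq_norm_sq]; simp; ring
          · rw [H2 i j (Ne.symm hij)]; simp [hij]
        simp_rw [e3]
        rw [Finset.sum_add_distrib, ← Finset.mul_sum, ← inner_sum, hu0]
        simp
      simp_rw [e2]
      rw [Finset.mul_sum]
    have hle : ∑ i, ‖u i‖ ^ 2 ≤ ∑ i, ‖w i‖ ^ 2 := by
      have : ∀ i, ‖w i‖ ^ 2 = ‖u i‖ ^ 2 + 2 * ⟪u i, μ⟫ + ‖μ‖ ^ 2 := by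
        intro i
        rw [← norm_add_sq_real]; simp [hu]
      simp_rw [this]
      rw [Finset.sum_add_distrib, Finset.sum_add_distrib, ← Finset.mul_sum, ← sum_inner, hu0]
      simp; positivity
    have e4 : ∑ S ∈ Finset.powersetCard b (Finset.univ : Finset (Fin n)),
      ‖(b : ℝ)⁻¹ • ∑ i ∈ S, w i - μ‖ ^ 2 = (b : ℝ)⁻¹ ^ 2 * ((c1 - c2) * ∑ i, ‖u i‖ ^ 2) := by
      rw [← key, Finset.mul_sum]
      refine Finset.sum_congr rfl fun S h => ?_
      rw [hS S h, norm_smul, mul_pow, Real.norm_eq_abs, sq_abs]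
    rw [e4]
    have hc1 : c1 = n.choose b * b / n := by field_simp; linarith
    have hc2 : c2 = (b - 1) * c1 / (n - 1) := by field_simp; linarith
    have e5 : (b : ℝ)⁻¹ ^ 2 * (c1 - c2) = n.choose b * (((n : ℝ) - b) / (b * ((n : ℝ) - 1)) * (n : ℝ)⁻¹) := by
      rw [hc2, hc1]; field_simp; ring
    calc _ = (b : ℝ)⁻¹ ^ 2 * (c1 - c2) * ∑ i, ‖u i‖ ^ 2 := by ring
      _ ≤ (b : ℝ)⁻¹ ^ 2 * (c1 - c2) * ∑ i, ‖w i‖ ^ 2 := by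
        apply mul_le_mul_of_nonneg_left hle
        rw [e5]
        have : 0 ≤ ((n : ℝ) - b) / (b * ((n : ℝ) - 1)) :=
          div_nonneg (by linarith) (mul_nonneg (by positivity) (by linarith))
        positivity
      _ = _ := by rw [e5]; ring

end helpers

/-- averaging over one coordinate of a finite product -/
lemma aux_tower {ι : Type*} [DecidableEq ι] [Fintype ι] {Ω : ι → Type*} [∀ i, Fintype (Ω i)]
    (k : ι) (g : ((i : ι) → Ω i) → ℝ) :
    ∑ ω, ∑ s : Ω k, g (Function.update ω k s) = (Fintype.card (Ω k)) * ∑ ω, g ω := by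
  rw [← Fintype.sum_prod_type' (f := fun ω s => g (Function.update ω k s))]
  let e : (((i : ι) → Ω i) × Ω k) ≃ (((i : ι) → Ω i) × Ω k) :=
    { toFun := fun q => (Function.update q.1 k q.2, q.1 k)
      invFun := fun q => (Function.update q.1 k q.2, q.1 k)
      left_inv := fun q => by simp
      right_inv := fun q => by simp }
  have := Equiv.sum_comp e (fun q => g q.1)
  simp only [e, Equiv.coe_fn_mk] at this
  rw [this, Fintype.sum_prod_type]
  simp [Finset.mul_sum]

lemma aux_step {H : Type*} [NormedAddCommGroup H] [InnerProductSpace ℝ H] [CompleteSpace H]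
    (n b : ℕ) (hn : 2 ≤ n) (hb1 : 1 ≤ b) (hbn : b ≤ n) (L : ℝ) (hL : 0 < L)
    (F : H → ℝ) (Fg : H → H)
    (FD : ∀ x y, F y ≤ F x + ⟪Fg x, y - x⟫ + L / 2 * ‖y - x‖ ^ 2)
    (FC : ∀ x y, F x + ⟪Fg x, y - x⟫ ≤ F y)
    (u : H) (hmin : ∀ y, F u ≤ F y)
    (d : H → ℝ) (dg : H → H)
    (hdsc : ∀ x y, d y ≥ d x + ⟪dg x, y - x⟫ + (1 / 2) * ‖y - x‖ ^ 2)
    (V : H → H → ℝ) (hV : ∀ x y, V x y = d y - d x - ⟪dg x, y - x⟫)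
    (k : ℕ) (a t p D0 : ℝ) (ha : a = ((k : ℝ) + 2) / (4 * L)) (ht : t⁻¹ = L * a + 1 / 2)
    (hp2 : p ≤ 1 / 2) (hD0 : 0 ≤ D0)
    (hpb : 4 * L * (((n : ℝ) - b) / (b * ((n : ℝ) - 1))) * a ≤ p)
    (xx yk zk c : H) (hxx : xx = (1 - t) • yk + t • zk) (w : Fin n → H)
    (hw : (n : ℝ)⁻¹ • ∑ i, w i + c = Fg xx)
    (hW : (n : ℝ)⁻¹ * ∑ i, ‖w i‖ ^ 2 ≤ 4 * L * (F xx - F u + D0))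
    {inst : Fintype {S : Finset (Fin n) // S ∈ Finset.powersetCard b (Finset.univ : Finset (Fin n))}}
    (vp yp zp : {S : Finset (Fin n) // S ∈ Finset.powersetCard b (Finset.univ : Finset (Fin n))} → H)
    (hvp : ∀ S : {S : Finset (Fin n) // S ∈ Finset.powersetCard b (Finset.univ : Finset (Fin n))},
      vp S = (b : ℝ)⁻¹ • ∑ i ∈ S.1, w i + c)
    (hyp : ∀ S : {S : Finset (Fin n) // S ∈ Finset.powersetCard b (Finset.univ : Finset (Fin n))}, yp S = xx - L⁻¹ • vp S)
    (hzp : ∀ S : {S : Finset (Fin n) // S ∈ Finset.powersetCard b (Finset.univ : Finset (Fin n))},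
      dg (zp S) = dg zk - a • vp S) :
    ∑ S : {S : Finset (Fin n) // S ∈ Finset.powersetCard b (Finset.univ : Finset (Fin n))},
      (((k : ℝ) + 2) ^ 2 / (16 * L) * (F (yp S) - F u) + V (zp S) u) ≤
      n.choose b * ((k : ℝ) * (k + 2) / (16 * L) * (F yk - F u) + V zk u
        + p * (k + 2) / (4 * L) * D0) := by
  have ha0 : 0 < a := by rw [ha]; positivity
  obtain ⟨hv0, hv2⟩ := aux_var n b hn hb1 hbn w
  rw [← Finset.sum_coe_sort] at hv0 hv2
  have hinst : inst = Finset.Subtype.fintype _ := Subsingleton.elim _ _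
  subst hinst
  set μ := (n : ℝ)⁻¹ • ∑ i, w i with hμ
  set δ := ((n : ℝ) - b) / (b * ((n : ℝ) - 1)) with hδ
  have hδ0 : 0 ≤ δ := by
    have h1 : (b : ℝ) ≤ n := by exact_mod_cast hbn
    have h2 : (2 : ℝ) ≤ n := by exact_mod_cast hn
    exact div_nonneg (by linarith) (mul_nonneg (by positivity) (by linarith))
  have hA : ((k : ℝ) + 2) ^ 2 / (16 * L) = a ^ 2 * L := by rw [ha]; field_simp; norm_num
  set e : {S : Finset (Fin n) // S ∈ Finset.powersetCard b (Finset.univ : Finset (Fin n))} → H := fun S => (b : ℝ)⁻¹ • ∑ i ∈ S.1, w i - μ with he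
  set g := Fg xx with hg
  set q : H := a ^ 2 • g - a • (zk - u) with hq
  set C := a ^ 2 * L * (F xx - F u) + V zk u - a * ⟪g, zk - u⟫ with hC
  have pt : ∀ S : {S : Finset (Fin n) // S ∈ Finset.powersetCard b (Finset.univ : Finset (Fin n))},
      ((k : ℝ) + 2) ^ 2 / (16 * L) * (F (yp S) - F u) + V (zp S) u ≤
        C + a ^ 2 * ‖e S‖ ^ 2 + ⟪e S, q⟫ := by
    intro S
    have hve : vp S = g + e S := by
      rw [hvp S, ← hw]; simp only [he]; abel
    have m1 := aux_mirror d dg hdsc V hV zk (zp S) (vp S) u a (hzp S)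
    have m2 := FD xx (yp S)
    have e1 : yp S - xx = - (L⁻¹ • vp S) := by rw [hyp S]; abel
    rw [e1, norm_neg, norm_smul, inner_neg_right, inner_smul_right,
      Real.norm_of_nonneg (inv_nonneg.2 hL.le)] at m2
    have m3 : a ^ 2 * L * (F (yp S) - F u) ≤ a ^ 2 * L * (F xx - F u)
        - a ^ 2 * ⟪g, vp S⟫ + a ^ 2 / 2 * ‖vp S‖ ^ 2 := by
      have : a ^ 2 * L * (F (yp S)) ≤ a ^ 2 * L * (F xx + -(L⁻¹ * ⟪g, vp S⟫) + L / 2 * (L⁻¹ * ‖vp S‖) ^ 2) := by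
        apply mul_le_mul_of_nonneg_left m2; positivity
      have e2 : a ^ 2 * L * (F xx + -(L⁻¹ * ⟪g, vp S⟫) + L / 2 * (L⁻¹ * ‖vp S‖) ^ 2)
        = a ^ 2 * L * F xx - a ^ 2 * ⟪g, vp S⟫ + a ^ 2 / 2 * ‖vp S‖ ^ 2 := by
        field_simp
        ring
      linarith
    have m4 : ‖vp S‖ ^ 2 = ‖g‖ ^ 2 + 2 * ⟪e S, g⟫ + ‖e S‖ ^ 2 := by
      rw [hve, norm_add_sq_real, real_inner_comm]
    have m5 : ⟪g, vp S⟫ = ‖g‖ ^ 2 + ⟪e S, g⟫ := by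
      rw [hve, inner_add_right, real_inner_self_eq_norm_sq, real_inner_comm]
    have m6 : ⟪vp S, zk - u⟫ = ⟪g, zk - u⟫ + ⟪e S, zk - u⟫ := by
      rw [hve, inner_add_left]
    have m7 : ⟪e S, q⟫ = a ^ 2 * ⟪e S, g⟫ - a * ⟪e S, zk - u⟫ := by
      rw [hq, inner_sub_right, inner_smul_right, inner_smul_right]
    rw [m5, m4] at m3
    rw [m4, m6] at m1
    rw [hA, m7, hC]
    linarith
  have hcard : Fintype.card {S : Finset (Fin n) // S ∈ Finset.powersetCard b (Finset.univ : Finset (Fin n))} = n.choose b := by simp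
  have hsum := Finset.sum_le_sum (s := Finset.univ) fun S _ => pt S
  rw [Finset.sum_add_distrib (f := fun S => C + a ^ 2 * ‖e S‖ ^ 2),
    Finset.sum_add_distrib (f := fun _ => C), ← sum_inner, hv0, inner_zero_left,
    Finset.sum_const, Finset.card_univ, hcard, ← Finset.mul_sum, nsmul_eq_mul] at hsum
  refine hsum.trans ?_
  have hN : (0 : ℝ) ≤ n.choose b := Nat.cast_nonneg _
  have s1 : a ^ 2 * ∑ S : {S : Finset (Fin n) // S ∈ Finset.powersetCard b (Finset.univ : Finset (Fin n))}, ‖e S‖ ^ 2 ≤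
      n.choose b * (a * p * (F xx - F u + D0)) := by
    have hD : 0 ≤ F xx - F u + D0 := by linarith [hmin xx]
    calc _ ≤ a ^ 2 * (n.choose b * (δ * (4 * L * (F xx - F u + D0)))) := by
          apply mul_le_mul_of_nonneg_left _ (sq_nonneg a)
          refine hv2.trans ?_
          gcongr
      _ = n.choose b * (a * (4 * L * δ * a) * (F xx - F u + D0)) := by ring
      _ ≤ _ := by gcongr
  have s2 : C + a * p * (F xx - F u + D0) ≤ (k : ℝ) * (k + 2) / (16 * L) * (F yk - F u) + V zk u
        + p * (k + 2) / (4 * L) * D0 := by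
    have t0 : t ≠ 0 := by
      intro h; rw [h, inv_zero] at ht
      have : 0 < L * a := by positivity
      linarith
    have c1 := FC xx u
    have c2 := FC xx yk
    rw [← hg] at c1 c2
    -- zk - u = (xx - u) - (t⁻¹ - 1) (yk - xx)
    have hz : zk - u = - (u - xx) - (t⁻¹ - 1) • (yk - xx) := by
      have : zk = t⁻¹ • (xx - (1 - t) • yk) := by
        rw [hxx, add_sub_cancel_left, smul_smul, inv_mul_cancel₀ t0, one_smul]
      have h2 : t⁻¹ • (xx - (1 - t) • yk) = t⁻¹ • xx - (t⁻¹ - 1) • yk := by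
        rw [smul_sub, smul_smul]; congr 2; field_simp
      rw [this, h2, smul_sub, sub_smul _ _ xx, one_smul]; abel
    have hi : ⟪g, zk - u⟫ = -⟪g, u - xx⟫ - (t⁻¹ - 1) * ⟪g, yk - xx⟫ := by
      rw [hz, inner_sub_right, inner_neg_right, inner_smul_right]
    have ht1 : 0 ≤ t⁻¹ - 1 := by
      have : L * a = ((k : ℝ) + 2) / 4 := by rw [ha]; field_simp
      rw [ht, this]; have := Nat.cast_nonneg (α := ℝ) k; linarith
    have c3 : a * (F xx - F u) ≤ a * -⟪g, u - xx⟫ := by gcongr; linarith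
    have c4 : a * ((t⁻¹ - 1) * ⟪g, yk - xx⟫) ≤ a * ((t⁻¹ - 1) * (F yk - F xx)) := by
      gcongr; linarith
    have c5 : (k : ℝ) * (k + 2) / (16 * L) = a * (t⁻¹ - 1) := by
      rw [ht, ha]; field_simp; ring
    have c6 : p * (k + 2) / (4 * L) = a * p := by rw [ha]; ring
    have c7 : 0 ≤ a * (1 / 2 - p) * (F xx - F u) :=
      mul_nonneg (mul_nonneg ha0.le (by linarith)) (by linarith [hmin xx])
    rw [c5, c6, hC, hi]
    rw [ht] at *
    linarith
  nlinarith [mul_le_mul_of_nonneg_left s2 hN]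

lemma aux_tower_le {ι : Type*} [DecidableEq ι] [Fintype ι] {Ω : ι → Type*} {inst : ∀ i, Fintype (Ω i)}
    (k : ι) [Nonempty (Ω k)] (g h : ((i : ι) → Ω i) → ℝ)
    (H : ∀ ω, ∑ s : Ω k, g (Function.update ω k s) ≤ (Fintype.card (Ω k)) * h ω) :
    ∑ ω, g ω ≤ ∑ ω, h ω := by
  have h1 := Finset.sum_le_sum (s := Finset.univ) fun ω _ => H ω
  rw [aux_tower, ← Finset.mul_sum] at h1
  exact le_of_mul_le_mul_left h1 (by exact_mod_cast Fintype.card_pos)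

/-- **Theorem 1, first bound.**
Algorithm 1 of AMSVRG with `η = 1/L`, `α_{k+1} = (k+2)/(4L)`, `1/τ_k = L α_{k+1} + 1/2`.
Each `f i : ℝ^d → ℝ` is convex and `L`-smooth, `n ≥ 2`, `f = (1/n) Σ f i` has minimizer `x*`;
`d` is differentiable and `1`-strongly convex with Bregman divergence `V`. If `p ∈ (0, 1/2]`
and the batch sizes `b_{k+1} ∈ {1,…,n}` satisfy `4 L δ_{k+1} α_{k+1} ≤ p` for `k = 0,…,m`,
where `δ_k = (n−b_k)/(b_k(n−1))`, then
`E[f(y_{m+1}) − f(x*)] ≤ 16 L V_{z₀}(x*)/(m+2)² + (5/2) p (f(y₀) − f(x*))`,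
the expectation being over the uniform product measure on batch choices. -/
theorem amsvrg_theorem1_first_bound {dd : ℕ} (n : ℕ) (hn : 2 ≤ n) (L : ℝ) (hL : 0 < L)
    (f : Fin n → EuclideanSpace ℝ (Fin dd) → ℝ)
    (f' : Fin n → EuclideanSpace ℝ (Fin dd) → EuclideanSpace ℝ (Fin dd))
    (hgrad : ∀ i x, HasGradientAt (f i) (f' i x) x)
    (hconv : ∀ i, ConvexOn ℝ Set.univ (f i))
    (hsmooth : ∀ i x y, ‖f' i x - f' i y‖ ≤ L * ‖x - y‖)
    (F : EuclideanSpace ℝ (Fin dd) → ℝ)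
    (hF : F = fun x => (n : ℝ)⁻¹ * ∑ i, f i x)
    (Fg : EuclideanSpace ℝ (Fin dd) → EuclideanSpace ℝ (Fin dd))
    (hFg : Fg = fun x => (n : ℝ)⁻¹ • ∑ i, f' i x)
    (xstar : EuclideanSpace ℝ (Fin dd)) (hmin : ∀ y, F xstar ≤ F y)
    (d : EuclideanSpace ℝ (Fin dd) → ℝ)
    (dg : EuclideanSpace ℝ (Fin dd) → EuclideanSpace ℝ (Fin dd))
    (hdgrad : ∀ x, HasGradientAt d (dg x) x)
    (hdsc : ∀ x y, d y ≥ d x + ⟪dg x, y - x⟫ + (1 / 2) * ‖y - x‖ ^ 2)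
    (V : EuclideanSpace ℝ (Fin dd) → EuclideanSpace ℝ (Fin dd) → ℝ)
    (hV : ∀ x y, V x y = d y - d x - ⟪dg x, y - x⟫)
    (m : ℕ)
    -- the parameter choices (8)
    (α : ℕ → ℝ) (hα : ∀ k, α (k + 1) = ((k : ℝ) + 2) / (4 * L))
    (τ : ℕ → ℝ) (hτ : ∀ k, (τ k)⁻¹ = L * α (k + 1) + 1 / 2)
    (p : ℝ) (hp0 : 0 < p) (hp2 : p ≤ 1 / 2)
    (b : ℕ → ℕ) (hb : ∀ k ≤ m, 1 ≤ b (k + 1) ∧ b (k + 1) ≤ n)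
    (δ : ℕ → ℝ) (hδ : ∀ k, δ k = ((n : ℝ) - b k) / (b k * ((n : ℝ) - 1)))
    (hpb : ∀ k ≤ m, 4 * L * δ (k + 1) * α (k + 1) ≤ p)
    (y0 z0 : EuclideanSpace ℝ (Fin dd))
    -- the iterates, as functions of the sample point
    (x y z v : ((k : Fin (m + 1)) →
        {S : Finset (Fin n) // S ∈ Finset.powersetCard (b (k.1 + 1)) Finset.univ}) →
      ℕ → EuclideanSpace ℝ (Fin dd))
    (hy0 : ∀ ω, y ω 0 = y0) (hz0 : ∀ ω, z ω 0 = z0)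
    (hx : ∀ ω, ∀ k ≤ m, x ω (k + 1) = (1 - τ k) • y ω k + τ k • z ω k)
    (hv : ∀ ω, ∀ k, ∀ hk : k ≤ m,
      v ω (k + 1) = (b (k + 1) : ℝ)⁻¹ •
          (∑ i ∈ (ω ⟨k, Nat.lt_succ_of_le hk⟩ : Finset (Fin n)),
            (f' i (x ω (k + 1)) - f' i y0)) + Fg y0)
    (hy : ∀ ω, ∀ k ≤ m, y ω (k + 1) = x ω (k + 1) - L⁻¹ • v ω (k + 1))
    (hz : ∀ ω, ∀ k ≤ m, dg (z ω (k + 1)) = dg (z ω k) - α (k + 1) • v ω (k + 1))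
    -- the expectation over the uniform product measure
    (E : (((k : Fin (m + 1)) →
        {S : Finset (Fin n) // S ∈ Finset.powersetCard (b (k.1 + 1)) Finset.univ}) → ℝ) → ℝ)
    (hE : ∀ g, E g = (Fintype.card ((k : Fin (m + 1)) →
        {S : Finset (Fin n) // S ∈ Finset.powersetCard (b (k.1 + 1)) Finset.univ}) : ℝ)⁻¹ *
      ∑ ω, g ω) :
    E (fun ω => F (y ω (m + 1)) - F xstar) ≤
      16 * L / ((m : ℝ) + 2) ^ 2 * V z0 xstar + (5 / 2) * p * (F y0 - F xstar) := by
  classical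
  have hn0 : (0 : ℝ) < n := by positivity
  have fd := fun i => aux_descent (f i) (f' i) (hgrad i) L (hsmooth i)
  have fc := fun i => aux_first_order (f i) (f' i) (hgrad i) (hconv i)
  have FD : ∀ x y, F y ≤ F x + ⟪Fg x, y - x⟫ + L / 2 * ‖y - x‖ ^ 2 := by
    intro x y
    have h1 := Finset.sum_le_sum (s := Finset.univ) fun i _ => fd i x y
    rw [Finset.sum_add_distrib, Finset.sum_add_distrib, ← sum_inner, Finset.sum_const,
      Finset.card_univ, Fintype.card_fin, nsmul_eq_mul] at h1
    have h2 := mul_le_mul_of_nonneg_left h1 (inv_nonneg.2 hn0.le)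
    simp only [hF, hFg]
    rw [real_inner_smul_left]
    refine h2.trans (le_of_eq ?_)
    field_simp
  have FC : ∀ x y, F x + ⟪Fg x, y - x⟫ ≤ F y := by
    intro x y
    have h1 := Finset.sum_le_sum (s := Finset.univ) fun i _ => fc i x y
    rw [Finset.sum_add_distrib, ← sum_inner] at h1
    have h2 := mul_le_mul_of_nonneg_left h1 (inv_nonneg.2 hn0.le)
    simp only [hF, hFg]
    rw [real_inner_smul_left]
    refine le_trans (le_of_eq ?_) h2
    ring
  have gstar : Fg xstar = 0 := by
    have h1 := FD xstar (xstar - L⁻¹ • Fg xstar)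
    have h2 := hmin (xstar - L⁻¹ • Fg xstar)
    rw [sub_sub_cancel_left, norm_neg, norm_smul, inner_neg_right, inner_smul_right,
      Real.norm_of_nonneg (inv_nonneg.2 hL.le), real_inner_self_eq_norm_sq] at h1
    have h3 : L / 2 * (L⁻¹ * ‖Fg xstar‖) ^ 2 = L⁻¹ / 2 * ‖Fg xstar‖ ^ 2 := by field_simp
    have h4 : L⁻¹ / 2 * ‖Fg xstar‖ ^ 2 ≤ 0 := by linarith
    have h5 : ‖Fg xstar‖ ^ 2 ≤ 0 := by
      by_contra h
      push Not at h
      have : 0 < L⁻¹ / 2 * ‖Fg xstar‖ ^ 2 := by positivity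
      linarith
    have : ‖Fg xstar‖ = 0 := by nlinarith [norm_nonneg (Fg xstar)]
    exact norm_eq_zero.1 this
  have coer : ∀ x, (n : ℝ)⁻¹ * ∑ i, ‖f' i x - f' i xstar‖ ^ 2 ≤ 2 * L * (F x - F xstar) := by
    intro x
    have h1 := Finset.sum_le_sum (s := Finset.univ) fun i _ =>
      aux_coercive (f i) (f' i) L hL (fd i) (fc i) x xstar
    rw [← Finset.mul_sum, Finset.sum_sub_distrib, Finset.sum_sub_distrib, ← sum_inner] at h1
    have h2 := mul_le_mul_of_nonneg_left h1 (inv_nonneg.2 hn0.le)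
    have h3 : ⟪Fg xstar, x - xstar⟫ = 0 := by rw [gstar, inner_zero_left]
    rw [hFg] at h3
    simp only [real_inner_smul_left] at h3
    refine h2.trans (le_of_eq ?_)
    simp only [hF]
    linear_combination (-2 * L) * h3
  have wb : ∀ x, (n : ℝ)⁻¹ * ∑ i, ‖f' i x - f' i y0‖ ^ 2 ≤
      4 * L * (F x - F xstar + (F y0 - F xstar)) := by
    intro x
    have h0 : ∀ i, ‖f' i x - f' i y0‖ ^ 2 ≤
        2 * ‖f' i x - f' i xstar‖ ^ 2 + 2 * ‖f' i y0 - f' i xstar‖ ^ 2 := by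
      intro i
      have e : f' i x - f' i y0 = (f' i x - f' i xstar) - (f' i y0 - f' i xstar) := by abel
      have := parallelogram_law_with_norm ℝ (f' i x - f' i xstar) (f' i y0 - f' i xstar)
      rw [← e] at this
      nlinarith [mul_self_nonneg ‖f' i x - f' i xstar + (f' i y0 - f' i xstar)‖]
    have h1 := Finset.sum_le_sum (s := Finset.univ) fun i _ => h0 i
    rw [Finset.sum_add_distrib, ← Finset.mul_sum, ← Finset.mul_sum] at h1
    have h2 := mul_le_mul_of_nonneg_left h1 (inv_nonneg.2 hn0.le)
    linarith [coer x, coer y0]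
  have D0 : 0 ≤ F y0 - F xstar := by linarith [hmin y0]
  have adapt : ∀ j ≤ m + 1, ∀ ω ω', (∀ i : Fin (m + 1), i.1 < j → ω i = ω' i) →
      y ω j = y ω' j ∧ z ω j = z ω' j := by
    intro j
    induction j with
    | zero => intro _ ω ω' _; simp [hy0, hz0]
    | succ j ih =>
      intro hj ω ω' h
      have hjm : j ≤ m := by omega
      obtain ⟨e1, e2⟩ := ih (by omega) ω ω' fun i hi => h i (by omega)
      have e3 : x ω (j + 1) = x ω' (j + 1) := by rw [hx ω j hjm, hx ω' j hjm, e1, e2]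
      have e4 : v ω (j + 1) = v ω' (j + 1) := by
        rw [hv ω j hjm, hv ω' j hjm, e3, h ⟨j, Nat.lt_succ_of_le hjm⟩ (Nat.lt_succ_self j)]
      refine ⟨by rw [hy ω j hjm, hy ω' j hjm, e3, e4], ?_⟩
      apply aux_dg_inj d dg hdsc
      rw [hz ω j hjm, hz ω' j hjm, e2, e4]
  have step : ∀ k, k ≤ m →
      ∑ ω, (((k : ℝ) + 2) ^ 2 / (16 * L) * (F (y ω (k + 1)) - F xstar) + V (z ω (k + 1)) xstar) ≤
      ∑ ω, ((k : ℝ) * (k + 2) / (16 * L) * (F (y ω k) - F xstar) + V (z ω k) xstar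
        + p * (k + 2) / (4 * L) * (F y0 - F xstar)) := by
    intro k hk
    obtain ⟨hb1, hbn⟩ := hb k hk
    let κ : Fin (m + 1) := ⟨k, Nat.lt_succ_of_le hk⟩
    have hcard : ∀ inst : Fintype {S : Finset (Fin n) // S ∈ Finset.powersetCard (b (κ.1 + 1))
        (Finset.univ : Finset (Fin n))}, @Fintype.card _ inst = n.choose (b (k + 1)) := by
      intro inst
      rw [← Nat.card_eq_fintype_card]
      simp [κ]
    have : Nonempty {S : Finset (Fin n) // S ∈ Finset.powersetCard (b (κ.1 + 1))
        (Finset.univ : Finset (Fin n))} := by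
      rw [← Fintype.card_pos_iff, hcard]
      exact Nat.choose_pos hbn
    apply aux_tower_le κ
    intro ω
    rw [hcard]
    have ad : ∀ s, y (Function.update ω κ s) k = y ω k ∧ z (Function.update ω κ s) k = z ω k := by
      intro s
      apply adapt k (by omega)
      intro i hi
      apply Function.update_of_ne
      intro h
      rw [h] at hi
      exact lt_irrefl _ hi
    have adx : ∀ s, x (Function.update ω κ s) (k + 1) = x ω (k + 1) := by
      intro s
      rw [hx _ k hk, hx ω k hk, (ad s).1, (ad s).2]
    refine aux_step n (b (k + 1)) hn hb1 hbn L hL F Fg FD FC xstar hmin d dg hdsc V hV k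
      (α (k + 1)) (τ k) p (F y0 - F xstar) (hα k) (hτ k) hp2 D0 ?_ (x ω (k + 1)) (y ω k) (z ω k)
      (Fg y0) (hx ω k hk) (fun i => f' i (x ω (k + 1)) - f' i y0) ?_ (wb _)
      (fun s => v (Function.update ω κ s) (k + 1))
      (fun s => y (Function.update ω κ s) (k + 1))
      (fun s => z (Function.update ω κ s) (k + 1)) ?_ ?_ ?_
    · rw [← hδ]; exact hpb k hk
    · rw [hFg]
      simp only [Finset.sum_sub_distrib, smul_sub, sub_add_cancel]
    · intro s
      have := hv (Function.update ω κ s) k hk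
      rw [adx] at this
      change v (Function.update ω κ s) (k + 1) = _ • (∑ i ∈ (Function.update ω κ s κ).1, _) + _ at this
      rw [Function.update_self] at this
      exact this
    · intro s
      rw [hy _ k hk, adx]
    · intro s
      rw [hz _ k hk, (ad s).2]
  have hV0 : ∀ a c, 0 ≤ V a c := by
    intro a c
    rw [hV]
    have := hdsc a c
    nlinarith [sq_nonneg ‖c - a‖]
  obtain ⟨N, hN⟩ : ∃ N : ℝ, N = (Nat.card ((k : Fin (m + 1)) →
        {S : Finset (Fin n) // S ∈ Finset.powersetCard (b (k.1 + 1))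
          (Finset.univ : Finset (Fin n))}) : ℝ) := ⟨_, rfl⟩
  have hNc : ∀ inst : Fintype ((k : Fin (m + 1)) →
        {S : Finset (Fin n) // S ∈ Finset.powersetCard (b (k.1 + 1))
          (Finset.univ : Finset (Fin n))}), (@Fintype.card _ inst : ℝ) = N := by
    intro inst
    rw [hN, Nat.card_eq_fintype_card]
  have hne : Nonempty ((k : Fin (m + 1)) →
        {S : Finset (Fin n) // S ∈ Finset.powersetCard (b (k.1 + 1))
          (Finset.univ : Finset (Fin n))}) := by
    refine ⟨fun k => Classical.choice ?_⟩
    obtain ⟨S, hS⟩ := Finset.powersetCard_nonempty.2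
      (show b (k.1 + 1) ≤ (Finset.univ : Finset (Fin n)).card by
        simpa using (hb k.1 (by omega)).2)
    exact ⟨⟨S, hS⟩⟩
  have hN0 : 0 < N := by
    rw [hN]
    exact_mod_cast Nat.card_pos
  have ind : ∀ j, j ≤ m + 1 →
      ∑ ω, ((j : ℝ) * (j + 2) / (16 * L) * (F (y ω j) - F xstar) + V (z ω j) xstar) ≤
      N * (V z0 xstar + p * ((j : ℝ) * (j + 3) / 2) / (4 * L) * (F y0 - F xstar)) := by
    intro j
    induction j with
    | zero =>
      intro _
      simp only [Nat.cast_zero, zero_mul, zero_div, mul_zero, add_zero, zero_add, hz0,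
        Finset.sum_const, Finset.card_univ, nsmul_eq_mul, hNc, le_refl]
    | succ j ih =>
      intro hj
      have i1 := ih (by omega)
      have i2 := step j (by omega)
      rw [Finset.sum_add_distrib (g := fun _ => p * ((j : ℝ) + 2) / (4 * L) * (F y0 - F xstar)),
        Finset.sum_const, Finset.card_univ, nsmul_eq_mul, hNc] at i2
      have i3 : ∑ ω, (((j + 1 : ℕ) : ℝ) * ((j + 1 : ℕ) + 2) / (16 * L) * (F (y ω (j + 1)) - F xstar)
          + V (z ω (j + 1)) xstar) ≤
          ∑ ω, (((j : ℝ) + 2) ^ 2 / (16 * L) * (F (y ω (j + 1)) - F xstar) + V (z ω (j + 1)) xstar) := by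
        refine Finset.sum_le_sum fun ω _ => ?_
        have : 0 ≤ F (y ω (j + 1)) - F xstar := by linarith [hmin (y ω (j + 1))]
        gcongr
        push_cast
        nlinarith
      refine i3.trans (i2.trans ((add_le_add_left i1 _).trans (le_of_eq ?_)))
      push_cast
      field_simp
      ring
  have i1 := ind m (by omega)
  have i2 := step m le_rfl
  rw [Finset.sum_add_distrib (g := fun _ => p * ((m : ℝ) + 2) / (4 * L) * (F y0 - F xstar)),
    Finset.sum_const, Finset.card_univ, nsmul_eq_mul, hNc] at i2
  have i3 : ((m : ℝ) + 2) ^ 2 / (16 * L) * ∑ ω, (F (y ω (m + 1)) - F xstar) ≤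
      ∑ ω, (((m : ℝ) + 2) ^ 2 / (16 * L) * (F (y ω (m + 1)) - F xstar) + V (z ω (m + 1)) xstar) := by
    rw [Finset.mul_sum]
    refine Finset.sum_le_sum fun ω _ => ?_
    linarith [hV0 (z ω (m + 1)) xstar]
  have i4 : ((m : ℝ) + 2) ^ 2 / (16 * L) * ∑ ω, (F (y ω (m + 1)) - F xstar) ≤
      N * (V z0 xstar + p * (((m : ℝ) + 1) * (m + 4) / 2) / (4 * L) * (F y0 - F xstar)) := by
    refine i3.trans (i2.trans ((add_le_add_left i1 _).trans (le_of_eq ?_)))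
    field_simp
    ring
  rw [hE, hNc]
  have hm2 : 0 < ((m : ℝ) + 2) ^ 2 := by positivity
  have i5 : N⁻¹ * ∑ ω, (F (y ω (m + 1)) - F xstar) ≤ 16 * L / ((m : ℝ) + 2) ^ 2 *
      (V z0 xstar + p * (((m : ℝ) + 1) * (m + 4) / 2) / (4 * L) * (F y0 - F xstar)) := by
    have := mul_le_mul_of_nonneg_left i4
      (show 0 ≤ N⁻¹ * (16 * L / ((m : ℝ) + 2) ^ 2) by positivity)
    refine le_trans (le_of_eq ?_) (this.trans (le_of_eq ?_))
    · field_simp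
    · field_simp
  refine le_trans (le_of_eq ?_) (i5.trans ?_)
  · congr!
  rw [mul_add]
  refine add_le_add le_rfl ?_
  have i6 : 16 * L / ((m : ℝ) + 2) ^ 2 * (p * (((m : ℝ) + 1) * (m + 4) / 2) / (4 * L) * (F y0 - F xstar))
    = (2 * (((m : ℝ) + 1) * (m + 4)) / ((m : ℝ) + 2) ^ 2) * (p * (F y0 - F xstar)) := by
    field_simp
    ring
  rw [i6, mul_assoc (5 / 2 : ℝ)]
  apply mul_le_mul_of_nonneg_right _ (mul_nonneg hp0.le D0)
  rw [div_le_iff₀ hm2]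
  nlinarith [sq_nonneg (m : ℝ)]
end
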